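/- Let A ∈ Mat_n(ℂ). Then the closure of the GL_n(ℂ)-conjugacy class of A contains a diagonalizable matrix (namely the semisimple part S of the Jordan–Chevalley decomposition A = S + N), and any two diagonalizable matrices lying in this closure are GL_n(ℂ)-conjugate to each other. -/

import Mathlib

/-- The `GL_n(ℂ)`-conjugacy class of a matrix `A`: `{g A g⁻¹ : g ∈ GL_n(ℂ)}`. -/
def conjClass {n : ℕ} (A : Matrix (Fin n) (Fin n) ℂ) : Set (Matrix (Fin n) (Fin n) ℂ) :=
  {B | ∃ g : (Matrix (Fin n) (Fin n) ℂ)ˣ,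
    B = (g : Matrix (Fin n) (Fin n) ℂ) * A * ((g⁻¹ : (Matrix (Fin n) (Fin n) ℂ)ˣ) : Matrix (Fin n) (Fin n) ℂ)}

/-- A matrix is diagonalizable if it is `GL_n(ℂ)`-conjugate to a diagonal matrix. -/
def IsDiagonalizable {n : ℕ} (A : Matrix (Fin n) (Fin n) ℂ) : Prop :=
  ∃ g : (Matrix (Fin n) (Fin n) ℂ)ˣ,
    (((g⁻¹ : (Matrix (Fin n) (Fin n) ℂ)ˣ) : Matrix (Fin n) (Fin n) ℂ) * A *
      (g : Matrix (Fin n) (Fin n) ℂ)).IsDiag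

/-- Adding a commuting nilpotent matrix does not change the characteristic polynomial. -/
theorem Matrix.charpoly_add_of_isNilpotent {K ι : Type*} [Field K] [Infinite K] [Fintype ι]
    [DecidableEq ι] {S N : Matrix ι ι K} (hN : IsNilpotent N) (h : Commute S N) :
    (S + N).charpoly = S.charpoly := by
  refine Polynomial.eq_of_infinite_eval_eq _ _ ?_
  have hfin : {z : K | S.charpoly.IsRoot z}.Finite :=
    Polynomial.finite_setOfPred_isRoot S.charpoly_monic.ne_zero
  refine hfin.infinite_compl.mono fun z hz ↦ ?_
  have hz' : (Matrix.scalar ι z - S).det ≠ 0 := by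
    simpa [Polynomial.IsRoot, Matrix.eval_charpoly] using hz
  set M := Matrix.scalar ι z - S with hM
  have hMN : Commute M N := (Matrix.scalar_commute z (fun _ ↦ Commute.all _ _) N).sub_left h
  have hMu : IsUnit M.det := hz'.isUnit
  have hinv : Commute M⁻¹ N := by
    have := hMN.eq
    calc M⁻¹ * N = M⁻¹ * (N * M) * M⁻¹ := by
          rw [← Matrix.mul_assoc, Matrix.mul_nonsing_inv_cancel_right _ _ hMu]
      _ = N * M⁻¹ := by rw [← this, Matrix.nonsing_inv_mul_cancel_left _ _ hMu]
  have hnil : IsNilpotent (M⁻¹ * N) := hinv.isNilpotent_mul_left hN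
  have hdet : (1 - M⁻¹ * N).det = 1 := by
    have h1 := (Matrix.isNilpotent_charpoly_sub_pow_of_isNilpotent hnil).eq_zero
    have h2 := congrArg (Polynomial.eval 1) h1
    simpa [Matrix.eval_charpoly, sub_eq_zero] using h2
  simp only [Set.mem_ofPred_eq, Matrix.eval_charpoly]
  have : Matrix.scalar ι z - (S + N) = M * (1 - M⁻¹ * N) := by
    rw [Matrix.mul_sub, Matrix.mul_nonsing_inv_cancel_left _ _ hMu, hM]
    simp [sub_sub]
  rw [this, Matrix.det_mul, hdet, mul_one]

/-- Over an algebraically closed field, every endomorphism is lower triangular in some basis. -/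
theorem Module.End.exists_basis_repr_eq_zero_of_lt {K : Type*} [Field K] [IsAlgClosed K] :
    ∀ (n : ℕ) {V : Type*} [AddCommGroup V] [Module K V] [FiniteDimensional K V]
      (_ : Module.finrank K V = n) (f : Module.End K V),
      ∃ b : Module.Basis (Fin n) K V, ∀ i j, i < j → b.repr (f (b j)) i = 0 := by
  intro n
  induction n with
  | zero =>
    intro V _ _ _ hV f
    exact ⟨Module.finBasisOfFinrankEq K V hV, fun i ↦ i.elim0⟩
  | succ n ih =>
    intro V _ _ _ hV f
    have : Nontrivial V := Module.nontrivial_of_finrank_pos (R := K) (by omega)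
    obtain ⟨μ, hμ⟩ := Module.End.exists_eigenvalue (K := K) (V := Module.Dual K V) f.dualMap
    obtain ⟨w, hw⟩ := hμ.exists_hasEigenvector
    have hw0 := hw.2
    have hwf (v : V) : w (f v) = μ * w v := by
      simpa using LinearMap.congr_fun hw.apply_eq_smul v
    have hinv (v : V) (hv : v ∈ LinearMap.ker w) : f v ∈ LinearMap.ker w := by
      simp_all
    have hrank : Module.finrank K (LinearMap.ker w) = n := by
      have := Module.Dual.finrank_ker_add_one_of_ne_zero hw0
      omega
    obtain ⟨b, hb⟩ := ih hrank (f.restrict hinv)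
    obtain ⟨y, hy⟩ : ∃ y, w y ≠ 0 := by
      by_contra! hcon
      exact hw0 (LinearMap.ext hcon)
    let c := Module.Basis.mkFinCons y b
      (fun c x hx h ↦ by
        have hx : w x = 0 := hx
        simpa [hx, hy] using congrArg w h)
      (fun z ↦ ⟨-(w z / w y), by simp [hy]⟩)
    have hc0 : c 0 = y := by simp [c, Module.Basis.coe_mkFinCons]
    have hcs (i : Fin n) : c i.succ = b i := by simp [c, Module.Basis.coe_mkFinCons]
    have hcoord0 : c.coord 0 ∘ₗ (LinearMap.ker w).subtype = 0 :=
      b.ext fun i ↦ by simp [← hcs]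
    have hcoords (j : Fin n) : c.coord j.succ ∘ₗ (LinearMap.ker w).subtype = b.coord j :=
      b.ext fun i ↦ by simp [← hcs, Finsupp.single_apply]
    refine ⟨c, fun i j hij ↦ ?_⟩
    obtain ⟨j, rfl⟩ := Fin.exists_succ_eq.mpr (Fin.ne_zero_of_lt hij)
    rw [hcs]
    have key : f (b j) = (f.restrict hinv (b j) : LinearMap.ker w) := rfl
    rw [key]
    induction i using Fin.cases with
    | zero => exact LinearMap.congr_fun hcoord0 (f.restrict hinv (b j))
    | succ i =>
      exact (LinearMap.congr_fun (hcoords i) _).trans (hb i j (Fin.succ_lt_succ_iff.mp hij))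

section conjClass

variable {n : ℕ} {A B C : Matrix (Fin n) (Fin n) ℂ}

theorem mem_conjClass_symm (h : B ∈ conjClass A) : A ∈ conjClass B := by
  obtain ⟨g, rfl⟩ := h
  exact ⟨g⁻¹, by simp [mul_assoc]⟩

theorem mem_conjClass_trans (hAB : B ∈ conjClass A) (hBC : C ∈ conjClass B) :
    C ∈ conjClass A := by
  obtain ⟨g, rfl⟩ := hAB
  obtain ⟨h, rfl⟩ := hBC
  exact ⟨h * g, by simp [mul_assoc]⟩

theorem mem_closure_conjClass_of_mem_conjClass (hAB : B ∈ closure (conjClass A))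
    (hBC : C ∈ conjClass B) : C ∈ closure (conjClass A) := by
  obtain ⟨g, rfl⟩ := hBC
  refine map_mem_closure (f := fun X ↦ (g : Matrix (Fin n) (Fin n) ℂ) * X *
    ((g⁻¹ : (Matrix (Fin n) (Fin n) ℂ)ˣ) : Matrix (Fin n) (Fin n) ℂ)) (by fun_prop) hAB
    fun X hX ↦ mem_conjClass_trans hX ⟨g, rfl⟩

theorem charpoly_eq_of_mem_conjClass (h : B ∈ conjClass A) : B.charpoly = A.charpoly := by
  obtain ⟨g, rfl⟩ := h
  simp

theorem charpoly_eq_of_mem_closure_conjClass (h : B ∈ closure (conjClass A)) :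
    B.charpoly = A.charpoly := by
  refine Polynomial.funext fun z ↦ ?_
  have hcl : IsClosed {X : Matrix (Fin n) (Fin n) ℂ | X.charpoly.eval z = A.charpoly.eval z} := by
    simp only [Matrix.eval_charpoly]
    exact isClosed_eq (by fun_prop) continuous_const
  exact closure_minimal
    (fun X hX ↦ congrArg (Polynomial.eval z) (charpoly_eq_of_mem_conjClass hX)) hcl h

theorem IsDiagonalizable.exists_diagonal_mem_conjClass (h : IsDiagonalizable A) :
    ∃ d : Fin n → ℂ, Matrix.diagonal d ∈ conjClass A := by
  obtain ⟨g, hg⟩ := h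
  exact ⟨_, g⁻¹, by rw [hg.diagonal_diag, inv_inv]⟩

theorem diagonal_comp_perm_mem_conjClass (d : Fin n → ℂ) (σ : Equiv.Perm (Fin n)) :
    Matrix.diagonal (d ∘ σ) ∈ conjClass (Matrix.diagonal d) := by
  refine ⟨⟨(1 : Matrix (Fin n) (Fin n) ℂ).submatrix σ id,
    (1 : Matrix (Fin n) (Fin n) ℂ).submatrix id σ, ?_, ?_⟩, ?_⟩
  · ext i j
    simp [Matrix.mul_apply, Matrix.one_apply]
  · rw [Matrix.submatrix_mul_equiv]
    simp
  · ext i j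
    simp +contextual [Matrix.mul_apply, Matrix.one_apply, Matrix.diagonal_apply]

theorem diagonal_mem_conjClass_of_charpoly_eq {d e : Fin n → ℂ}
    (h : (Matrix.diagonal d).charpoly = (Matrix.diagonal e).charpoly) :
    Matrix.diagonal e ∈ conjClass (Matrix.diagonal d) := by
  have hroots (u : Fin n → ℂ) :
      (Matrix.diagonal u).charpoly.roots = Finset.univ.val.map u := by
    rw [Matrix.charpoly_diagonal, ← Polynomial.roots_multiset_prod_X_sub_C (Finset.univ.val.map u),
      Multiset.map_map]
    rfl
  have hmap : Finset.univ.val.map d = Finset.univ.val.map e := by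
    rw [← hroots, ← hroots, h]
  have hcard (z : ℂ) : Nonempty ({i // e i = z} ≃ {i // d i = z}) := by
    have := congrArg (Multiset.count z) hmap
    rw [Multiset.count_map, Multiset.count_map] at this
    refine Fintype.card_eq.mp ?_
    rw [Fintype.card_subtype, Fintype.card_subtype]
    simpa [Finset.card_def, eq_comm] using this.symm
  let σ : Equiv.Perm (Fin n) := Equiv.ofFiberEquiv fun z ↦ (hcard z).some
  have hσ : d ∘ σ = e := funext fun i ↦ Equiv.ofFiberEquiv_map _ i
  rw [← hσ]
  exact diagonal_comp_perm_mem_conjClass d σ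

theorem IsDiagonalizable.mem_conjClass_of_charpoly_eq (hB : IsDiagonalizable B)
    (hC : IsDiagonalizable C) (h : B.charpoly = C.charpoly) : C ∈ conjClass B := by
  obtain ⟨d, hd⟩ := hB.exists_diagonal_mem_conjClass
  obtain ⟨e, he⟩ := hC.exists_diagonal_mem_conjClass
  refine mem_conjClass_trans (mem_conjClass_trans hd ?_) (mem_conjClass_symm he)
  apply diagonal_mem_conjClass_of_charpoly_eq
  rw [charpoly_eq_of_mem_conjClass hd, charpoly_eq_of_mem_conjClass he, h]

theorem exists_lowerTriangular_mem_conjClass (A : Matrix (Fin n) (Fin n) ℂ) :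
    ∃ T ∈ conjClass A, ∀ i j, i < j → T i j = 0 := by
  obtain ⟨b, hb⟩ := Module.End.exists_basis_repr_eq_zero_of_lt n (by simp) (Matrix.toLin' A)
  refine ⟨LinearMap.toMatrix b b (Matrix.toLin' A),
    ⟨⟨b.toMatrix (Pi.basisFun ℂ (Fin n)), (Pi.basisFun ℂ (Fin n)).toMatrix b,
      Module.Basis.toMatrix_mul_toMatrix_flip _ _,
      Module.Basis.toMatrix_mul_toMatrix_flip _ _⟩, ?_⟩, fun i j hij ↦ ?_⟩
  · have : LinearMap.toMatrix (Pi.basisFun ℂ (Fin n)) (Pi.basisFun ℂ (Fin n))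
        (Matrix.toLin' A) = A := LinearMap.toMatrix'_toLin' A
    simp only [Units.inv_mk]
    conv_rhs => rw [← this]
    exact (basis_toMatrix_mul_linearMap_toMatrix_mul_basis_toMatrix _ _ _ _ _).symm
  · rw [LinearMap.toMatrix_apply]
    exact hb i j hij

theorem diagonal_diag_mem_closure_conjClass_of_lowerTriangular
    {T : Matrix (Fin n) (Fin n) ℂ} (hT : ∀ i j, i < j → T i j = 0) :
    Matrix.diagonal T.diag ∈ closure (conjClass T) := by
  let F : ℂ → Matrix (Fin n) (Fin n) ℂ := fun t ↦
    Matrix.of fun i j ↦ t ^ ((i : ℕ) - (j : ℕ)) * T i j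
  have hF : Continuous F := continuous_matrix fun i j ↦ by
    simp only [F, Matrix.of_apply]
    fun_prop
  have hF0 : F 0 = Matrix.diagonal T.diag := by
    ext i j
    rcases lt_trichotomy i j with h | rfl | h
    · simp [F, hT i j h, h.ne]
    · simp [F]
    · have : (i : ℕ) - (j : ℕ) ≠ 0 := by have := Fin.lt_def.mp h; omega
      simp [F, this, h.ne']
  have hlim : Filter.Tendsto F (nhdsWithin 0 {0}ᶜ) (nhds (Matrix.diagonal T.diag)) :=
    hF0 ▸ hF.continuousAt.tendsto.mono_left nhdsWithin_le_nhds
  refine mem_closure_of_tendsto hlim (eventually_nhdsWithin_of_forall fun t ht ↦ ?_)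
  have ht : t ≠ 0 := ht
  refine ⟨⟨Matrix.diagonal fun i ↦ t ^ (i : ℕ), Matrix.diagonal fun i ↦ (t ^ (i : ℕ))⁻¹,
    by simp [ht], by simp [ht]⟩, ?_⟩
  ext i j
  simp only [F, Matrix.of_apply, Units.inv_mk, Matrix.mul_diagonal, Matrix.diagonal_mul]
  rcases lt_or_ge i j with h | h
  · simp [hT i j h]
  · rw [pow_sub₀ t ht h]
    ring

theorem exists_diagonal_mem_closure_conjClass (A : Matrix (Fin n) (Fin n) ℂ) :
    ∃ d : Fin n → ℂ, Matrix.diagonal d ∈ closure (conjClass A) := by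
  obtain ⟨T, hTA, hT⟩ := exists_lowerTriangular_mem_conjClass A
  exact ⟨T.diag, closure_mono (fun _ hX ↦ mem_conjClass_trans hTA hX)
    (diagonal_diag_mem_closure_conjClass_of_lowerTriangular hT)⟩

end conjClass

/-- The closure of the `GL_n(ℂ)`-conjugacy class of `A` contains a
diagonalizable matrix (namely the semisimple part `S` of the Jordan–Chevalley decomposition
`A = S + N`), and any two diagonalizable matrices in this closure are conjugate. -/
theorem unique_semisimple_class_in_closure
    {n : ℕ} (A S N : Matrix (Fin n) (Fin n) ℂ)
    (hA : A = S + N) (hS : IsDiagonalizable S) (hN : IsNilpotent N)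
    (hcomm : S * N = N * S) :
    S ∈ closure (conjClass A) ∧
      ∀ B C : Matrix (Fin n) (Fin n) ℂ, IsDiagonalizable B → IsDiagonalizable C →
        B ∈ closure (conjClass A) → C ∈ closure (conjClass A) → C ∈ conjClass B := by
  refine ⟨?_, fun B C hB hC hBA hCA ↦ hB.mem_conjClass_of_charpoly_eq hC ?_⟩
  · obtain ⟨d, hd⟩ := exists_diagonal_mem_closure_conjClass A
    have hdiag : IsDiagonalizable (Matrix.diagonal d) := ⟨1, by simp⟩
    refine mem_closure_conjClass_of_mem_conjClass hd (hdiag.mem_conjClass_of_charpoly_eq hS ?_)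
    rw [charpoly_eq_of_mem_closure_conjClass hd, hA, Matrix.charpoly_add_of_isNilpotent hN hcomm]
  · rw [charpoly_eq_of_mem_closure_conjClass hBA, charpoly_eq_of_mem_closure_conjClass hCA]
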